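/- arXiv:2403.14363 — 7 statements merged into one kernel-verified Lean document; each statement's English description precedes it below -/
import Mathlib

section
/- Let α, β be finite types, n ≥ 1, and let {(η i, ρ i)}_{i ∈ Fin n} be an ensemble of density matrices on Matrix (α × β) (α × β) ℂ. Let M : Fin n → Matrix (α × β) (α × β) ℂ be a POVM with n outcomes. Then M attains the maximum of the value ∑ i, η i * (Tr (Γ(ρ i) * N i)).re over all POVMs N with n outcomes (i.e., for every POVM N, ∑ i, η i * (Tr (Γ(ρ i) * N i)).re ≤ ∑ i, η i * (Tr (Γ(ρ i) * M i)).re) if and only if for every i ∈ Fin n the matrix (∑ j, η j • (Γ(ρ j) * M j)) − η i • Γ(ρ i) is positive semidefinite. -/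
open Matrix BigOperators
open scoped ComplexOrder

/-- A POVM with `n` outcomes: each element is positive semidefinite and they sum to the identity. -/
def IsPOVM {ι : Type*} [Fintype ι] [DecidableEq ι] {n : ℕ} (M : Fin n → Matrix ι ι ℂ) : Prop :=
  (∀ i, (M i).PosSemidef) ∧ ∑ i, M i = 1

/-- Partial transposition (with respect to the second subsystem) on a bipartite system. -/
def ptAB {α β : Type*} (ρ : Matrix (α × β) (α × β) ℂ) : Matrix (α × β) (α × β) ℂ :=
  Matrix.of fun p q => ρ (p.1, q.2) (q.1, p.2)

section Trace

variable {ι : Type*} [Fintype ι]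

lemma Matrix.PosSemidef.exists_eq_conjTranspose_mul_self {A : Matrix ι ι ℂ}
    (hA : A.PosSemidef) : ∃ B : Matrix ι ι ℂ, A = Bᴴ * B := by
  classical
  open scoped MatrixOrder Matrix.Norms.L2Operator in
  exact CStarAlgebra.nonneg_iff_eq_star_mul_self.mp hA.nonneg

lemma Matrix.PosSemidef.re_trace_mul_nonneg {A B : Matrix ι ι ℂ}
    (hA : A.PosSemidef) (hB : B.PosSemidef) : 0 ≤ (A * B).trace.re := by
  obtain ⟨C, rfl⟩ := hA.exists_eq_conjTranspose_mul_self
  rw [Matrix.mul_assoc, Matrix.trace_mul_comm]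
  exact (Complex.nonneg_iff.mp (hB.mul_mul_conjTranspose_same C).trace_nonneg).1

lemma Matrix.PosSemidef.mul_eq_zero_of_re_trace_eq_zero {A B : Matrix ι ι ℂ}
    (hA : A.PosSemidef) (hB : B.PosSemidef) (h : (A * B).trace.re = 0) : A * B = 0 := by
  obtain ⟨C, rfl⟩ := hA.exists_eq_conjTranspose_mul_self
  obtain ⟨D, rfl⟩ := hB.exists_eq_conjTranspose_mul_self
  have htr : (Cᴴ * C * (Dᴴ * D)).trace = ((C * Dᴴ)ᴴ * (C * Dᴴ)).trace := by
    rw [Matrix.conjTranspose_mul, Matrix.conjTranspose_conjTranspose, ← Matrix.mul_assoc,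
      Matrix.trace_mul_comm]
    simp only [Matrix.mul_assoc]
  have him := (Complex.nonneg_iff.mp
    (Matrix.posSemidef_conjTranspose_mul_self (C * Dᴴ)).trace_nonneg).2
  rw [htr] at h
  have hCD : C * Dᴴ = 0 :=
    Matrix.trace_conjTranspose_mul_self_eq_zero_iff.mp (Complex.ext h him.symm)
  rw [Matrix.mul_assoc, ← Matrix.mul_assoc C, hCD]
  simp

lemma Matrix.re_trace_conjTranspose (A : Matrix ι ι ℂ) : Aᴴ.trace.re = A.trace.re := by
  simp [Matrix.trace_conjTranspose]

lemma Matrix.IsHermitian.re_trace_mul_conjTranspose {P : Matrix ι ι ℂ} (hP : P.IsHermitian)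
    (A : Matrix ι ι ℂ) : (Aᴴ * P).trace.re = (A * P).trace.re := by
  rw [← Matrix.re_trace_conjTranspose (A * P), Matrix.conjTranspose_mul, hP.eq,
    Matrix.trace_mul_comm]

lemma Matrix.trace_mul_vecMulVec (A : Matrix ι ι ℂ) (v w : ι → ℂ) :
    (A * Matrix.vecMulVec v w).trace = w ⬝ᵥ (A *ᵥ v) := by
  rw [Matrix.mul_vecMulVec, Matrix.trace_vecMulVec, dotProduct_comm]

lemma Matrix.IsHermitian.posSemidef_of_re_trace_nonneg {A : Matrix ι ι ℂ} (hA : A.IsHermitian)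
    (h : ∀ v : ι → ℂ, 0 ≤ (A * Matrix.vecMulVec v (star v)).trace.re) : A.PosSemidef := by
  refine .of_dotProduct_mulVec_nonneg hA fun v => Complex.nonneg_iff.mpr ⟨?_, ?_⟩
  · simpa only [Matrix.trace_mul_vecMulVec] using h v
  · exact (hA.im_star_dotProduct_mulVec_self v).symm

end Trace

lemma nonneg_of_forall_small_mul_le {a b c : ℝ} (hc : 0 ≤ c)
    (h : ∀ t : ℝ, 0 < t → t * c ≤ 2 → t * b ≤ a) : 0 ≤ a := by
  by_contra! ha
  have hac := mul_nonneg (neg_nonneg.mpr ha.le) hc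
  have hb := abs_nonneg b
  have hd : 0 < 2 * (|b| + 1) + -a * c := by linarith
  set d := 2 * (|b| + 1) + -a * c
  have ht : 0 < -a / d := div_pos (neg_pos.mpr ha) hd
  have htc : -a / d * c ≤ 2 := by
    rw [div_mul_eq_mul_div, div_le_iff₀ hd]
    linarith
  have htb := h _ ht htc
  rw [div_mul_eq_mul_div, div_le_iff₀ hd] at htb
  nlinarith [neg_abs_le b, mul_nonneg_of_nonpos_of_nonpos ha.le (neg_nonpos.mpr hac)]

section Optimality

variable {ι : Type*} [Fintype ι] [DecidableEq ι] {n : ℕ}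

/-- Conjugating a POVM by `1 - tP` and assigning the missing weight to outcome `i`. -/
lemma IsPOVM.perturb {M : Fin n → Matrix ι ι ℂ} (hM : IsPOVM M) (i : Fin n)
    {P : Matrix ι ι ℂ} (hP : P.PosSemidef) {c : ℝ} (hPP : P * P = c • P)
    {t : ℝ} (ht : 0 ≤ t) (htc : t * c ≤ 2) :
    IsPOVM fun j => (1 - t • P) * M j * (1 - t • P) +
      if j = i then (t * (2 - t * c)) • P else 0 := by
  have hB : (1 - t • P)ᴴ = 1 - t • P := by simp [hP.isHermitian.eq]
  refine ⟨fun j => ?_, ?_⟩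
  · have hconj := (hM.1 j).mul_mul_conjTranspose_same (1 - t • P)
    rw [hB] at hconj
    beta_reduce
    split_ifs
    · exact hconj.add (hP.smul (mul_nonneg ht (sub_nonneg.mpr htc)))
    · rwa [add_zero]
  · rw [Finset.sum_add_distrib, ← Finset.sum_mul, ← Finset.mul_sum, hM.2]
    simp only [Finset.sum_ite_eq', Finset.mem_univ, if_true, mul_one, sub_mul, mul_sub, one_mul,
      smul_mul_assoc, mul_smul_comm, hPP]
    module

lemma re_trace_mul_perturb (X M P : Matrix ι ι ℂ) (hX : X.IsHermitian) (hM : M.IsHermitian)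
    (hP : P.IsHermitian) (t : ℝ) :
    (X * ((1 - t • P) * M * (1 - t • P))).trace.re =
      (X * M).trace.re - 2 * t * (X * M * P).trace.re + t ^ 2 * (X * (P * M * P)).trace.re := by
  have hXPM : (X * (P * M)).trace.re = (X * M * P).trace.re := by
    rw [← Matrix.re_trace_conjTranspose]
    simp only [Matrix.conjTranspose_mul, hX.eq, hM.eq, hP.eq]
    rw [Matrix.trace_mul_comm, ← Matrix.mul_assoc]
  have hexp : X * ((1 - t • P) * M * (1 - t • P)) =
      X * M - t • (X * (P * M)) - t • (X * M * P) + (t ^ 2) • (X * (P * M * P)) := by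
    simp only [sub_mul, mul_sub, one_mul, mul_one, smul_mul_assoc, mul_smul_comm, smul_sub,
      smul_smul, Matrix.mul_assoc]
    module
  rw [hexp]
  simp only [Matrix.trace_add, Matrix.trace_sub, Matrix.trace_smul, Complex.add_re, Complex.sub_re,
    Complex.smul_re, smul_eq_mul, hXPM]
  ring

lemma IsPOVM.re_trace_le_of_isMax {X M : Fin n → Matrix ι ι ℂ} (hX : ∀ i, (X i).IsHermitian)
    (hM : IsPOVM M)
    (hmax : ∀ N, IsPOVM N → ∑ i, (X i * N i).trace.re ≤ ∑ i, (X i * M i).trace.re)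
    (i : Fin n) (v : ι → ℂ) :
    (X i * Matrix.vecMulVec v (star v)).trace.re ≤
      ((∑ j, X j * M j) * Matrix.vecMulVec v (star v)).trace.re := by
  set P := Matrix.vecMulVec v (star v) with hP_def
  have hP : P.PosSemidef := Matrix.posSemidef_vecMulVec_self_star v
  obtain ⟨hc, him⟩ := Complex.nonneg_iff.mp (dotProduct_star_self_nonneg v)
  set c : ℝ := (star v ⬝ᵥ v).re
  have hvc : star v ⬝ᵥ v = (c : ℂ) :=
    Complex.ext rfl him.symm
  have hPP : P * P = c • P := by
    rw [hP_def, Matrix.vecMulVec_mul_vecMulVec, hvc, Matrix.vecMulVec_smul]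
    ext
    simp
  have key : ∀ t : ℝ, 0 < t → t * c ≤ 2 →
      t * (∑ j, (X j * (P * M j * P)).trace.re - c * (X i * P).trace.re) ≤
        2 * (((∑ j, X j * M j) * P).trace.re - (X i * P).trace.re) := by
    intro t ht htc
    have h := hmax _ (hM.perturb i hP hPP ht.le htc)
    have hterm : ∀ j, (X j * ((1 - t • P) * M j * (1 - t • P) +
        if j = i then (t * (2 - t * c)) • P else 0)).trace.re =
        (X j * M j).trace.re - 2 * t * (X j * M j * P).trace.re
          + t ^ 2 * (X j * (P * M j * P)).trace.re
          + if j = i then t * (2 - t * c) * (X i * P).trace.re else 0 := by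
      intro j
      rw [mul_add, Matrix.trace_add, Complex.add_re,
        re_trace_mul_perturb _ _ _ (hX j) (hM.1 j).isHermitian hP.isHermitian]
      split_ifs with hj
      · subst hj
        simp
      · simp
    simp only [hterm, Finset.sum_add_distrib, Finset.sum_sub_distrib, ← Finset.mul_sum,
      Finset.sum_ite_eq', Finset.mem_univ, if_true] at h
    rw [Finset.sum_mul, Matrix.trace_sum, Complex.re_sum]
    refine le_of_mul_le_mul_left ?_ ht
    linarith
  linarith [nonneg_of_forall_small_mul_le hc key]

lemma IsPOVM.re_trace_sum_sub_mul {M : Fin n → Matrix ι ι ℂ} (hM : IsPOVM M)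
    (K : Matrix ι ι ℂ) (X : Fin n → Matrix ι ι ℂ) :
    ∑ i, ((K - X i) * M i).trace.re = K.trace.re - ∑ i, (X i * M i).trace.re := by
  simp only [sub_mul, Matrix.trace_sub, Complex.sub_re, Finset.sum_sub_distrib]
  rw [← Complex.re_sum, ← Matrix.trace_sum, ← Finset.mul_sum, hM.2, mul_one]

theorem IsPOVM.isMax_iff_posSemidef {X M : Fin n → Matrix ι ι ℂ} (hX : ∀ i, (X i).IsHermitian)
    (hM : IsPOVM M) :
    (∀ N, IsPOVM N → ∑ i, (X i * N i).trace.re ≤ ∑ i, (X i * M i).trace.re) ↔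
      ∀ i, ((∑ j, X j * M j) - X i).PosSemidef := by
  have htrK : (∑ j, X j * M j).trace.re = ∑ i, (X i * M i).trace.re := by
    rw [Matrix.trace_sum, Complex.re_sum]
  set K := ∑ j, X j * M j with hK
  refine ⟨fun hmax => ?_, fun h N hN => ?_⟩
  · set S : Matrix ι ι ℂ := (1 / 2 : ℝ) • (K + Kᴴ) with hS
    have hSherm : S.IsHermitian := by
      simp [hS, Matrix.IsHermitian, add_comm]
    have hreS : ∀ P : Matrix ι ι ℂ, P.IsHermitian → (S * P).trace.re = (K * P).trace.re := by
      intro P hP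
      simp only [hS, smul_mul_assoc, add_mul, Matrix.trace_smul, Matrix.trace_add, Complex.smul_re,
        Complex.add_re, hP.re_trace_mul_conjTranspose, smul_eq_mul]
      ring
    have hpos : ∀ i, (S - X i).PosSemidef := fun i =>
      (hSherm.sub (hX i)).posSemidef_of_re_trace_nonneg fun v => by
        rw [sub_mul, Matrix.trace_sub, Complex.sub_re,
          hreS _ (Matrix.posSemidef_vecMulVec_self_star v).isHermitian]
        exact sub_nonneg.mpr (hM.re_trace_le_of_isMax hX hmax i v)
    have hsum : ∑ i, ((S - X i) * M i).trace.re = 0 := by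
      have hone := hreS 1 Matrix.isHermitian_one
      rw [mul_one, mul_one] at hone
      rw [hM.re_trace_sum_sub_mul, hone, htrK, sub_self]
    have hzero : ∀ i, (S - X i) * M i = 0 := fun i =>
      (hpos i).mul_eq_zero_of_re_trace_eq_zero (hM.1 i) <|
        (Finset.sum_eq_zero_iff_of_nonneg
          fun j _ => (hpos j).re_trace_mul_nonneg (hM.1 j)).mp hsum i (Finset.mem_univ i)
    have hSK : S = K := by
      rw [← mul_one S, ← hM.2, Finset.mul_sum, hK]
      exact Finset.sum_congr rfl fun i _ => sub_eq_zero.mp (by rw [← sub_mul, hzero i])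
    rwa [hSK] at hpos
  · have hnonneg : 0 ≤ ∑ i, ((K - X i) * N i).trace.re :=
      Finset.sum_nonneg fun i _ => (h i).re_trace_mul_nonneg (hN.1 i)
    rw [hN.re_trace_sum_sub_mul, htrK] at hnonneg
    linarith

end Optimality

lemma Matrix.IsHermitian.ptAB {α β : Type*} {ρ : Matrix (α × β) (α × β) ℂ}
    (hρ : ρ.IsHermitian) : (ptAB ρ).IsHermitian :=
  Matrix.IsHermitian.ext fun p q => hρ.apply (p.1, q.2) (q.1, p.2)

theorem stmt0 {α β : Type*} [Fintype α] [DecidableEq α] [Fintype β] [DecidableEq β]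
    {n : ℕ} (hn : 1 ≤ n)
    (η : Fin n → ℝ) (ρ : Fin n → Matrix (α × β) (α × β) ℂ)
    (hη : ∀ i, 0 < η i) (hsum : ∑ i, η i = 1)
    (hρ : ∀ i, (ρ i).PosSemidef ∧ (ρ i).trace = 1)
    (M : Fin n → Matrix (α × β) (α × β) ℂ) (hM : IsPOVM M) :
    (∀ N : Fin n → Matrix (α × β) (α × β) ℂ, IsPOVM N →
        ∑ i, η i * ((ptAB (ρ i) * N i).trace).re ≤ ∑ i, η i * ((ptAB (ρ i) * M i).trace).re)
      ↔ ∀ i, ((∑ j, η j • (ptAB (ρ j) * M j)) - η i • ptAB (ρ i)).PosSemidef := by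
  have hX : ∀ i, (η i • ptAB (ρ i)).IsHermitian := fun i =>
    (hρ i).1.isHermitian.ptAB.smul (IsSelfAdjoint.all (η i))
  simpa only [smul_mul_assoc, Matrix.trace_smul, Complex.smul_re, smul_eq_mul] using
    hM.isMax_iff_posSemidef hX
end

section
/- Let ι be a finite type, n ≥ 1, and let {(η i, ρ i)}_{i ∈ Fin n} be an ensemble of density matrices on Matrix ι ι ℂ. Then there exists a POVM M with n outcomes such that ∑ i, η i * (Tr (ρ i * M i)).re = 1 if and only if ρ i * ρ j = 0 for all i ≠ j. (Moreover ∑ i, η i * (Tr (ρ i * M i)).re ≤ 1 for every POVM M, so the ensemble is perfectly discriminable by a global measurement exactly when its states are mutually orthogonal.) -/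
open Matrix BigOperators
open scoped ComplexOrder

/-- A product of positive semidefinite matrices has the trace of some `Zᴴ * Z`, whose vanishing
forces the product to vanish. -/
lemma Matrix.PosSemidef.exists_trace_mul_eq {ι : Type*} [Fintype ι] [DecidableEq ι]
    {A B : Matrix ι ι ℂ} (hA : A.PosSemidef) (hB : B.PosSemidef) :
    ∃ Z : Matrix ι ι ℂ, (A * B).trace = (Zᴴ * Z).trace ∧ (Z = 0 → A * B = 0) := by
  open scoped MatrixOrder in
  obtain ⟨X, rfl⟩ := CStarAlgebra.nonneg_iff_eq_star_mul_self.mp hA.nonneg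
  open scoped MatrixOrder in
  obtain ⟨Y, rfl⟩ := CStarAlgebra.nonneg_iff_eq_star_mul_self.mp hB.nonneg
  simp only [Matrix.star_eq_conjTranspose]
  refine ⟨X * Yᴴ, ?_, fun h => ?_⟩
  · rw [conjTranspose_mul, conjTranspose_conjTranspose, ← Matrix.mul_assoc, Matrix.trace_mul_comm]
    simp only [Matrix.mul_assoc]
  · calc Xᴴ * X * (Yᴴ * Y) = Xᴴ * (X * Yᴴ) * Y := by simp only [Matrix.mul_assoc]
      _ = 0 := by rw [h, Matrix.mul_zero, Matrix.zero_mul]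

lemma Matrix.PosSemidef.trace_mul_nonneg {ι : Type*} [Fintype ι] [DecidableEq ι]
    {A B : Matrix ι ι ℂ} (hA : A.PosSemidef) (hB : B.PosSemidef) : 0 ≤ (A * B).trace := by
  obtain ⟨Z, hZ, -⟩ := hA.exists_trace_mul_eq hB
  rw [hZ]
  exact (posSemidef_conjTranspose_mul_self Z).trace_nonneg

lemma Matrix.PosSemidef.mul_eq_zero_of_re_trace_mul_eq_zero {ι : Type*} [Fintype ι]
    [DecidableEq ι] {A B : Matrix ι ι ℂ} (hA : A.PosSemidef) (hB : B.PosSemidef)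
    (h : (A * B).trace.re = 0) : A * B = 0 := by
  obtain ⟨Z, hZ, hZ0⟩ := hA.exists_trace_mul_eq hB
  refine hZ0 (trace_conjTranspose_mul_self_eq_zero_iff.mp ?_)
  rw [← hZ]
  exact Complex.ext h (Complex.nonneg_iff.mp (hA.trace_mul_nonneg hB)).2.symm

/-- A Hermitian matrix has a commuting Hermitian generalized inverse. -/
lemma Matrix.IsHermitian.exists_generalizedInverse {ι : Type*} [Fintype ι] [DecidableEq ι]
    {A : Matrix ι ι ℂ} (hA : A.IsHermitian) :
    ∃ B : Matrix ι ι ℂ, B.IsHermitian ∧ A * B = B * A ∧ A * B * A = A := by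
  have hsa : IsSelfAdjoint A := hA
  have hc (f : ℝ → ℝ) : ContinuousOn f (spectrum ℝ A) :=
    Matrix.finite_real_spectrum.continuousOn f
  refine ⟨cfc (fun x : ℝ => x⁻¹) A, cfc_predicate (fun x : ℝ => x⁻¹) A, ?_, ?_⟩
  · exact ((Commute.refl A).cfc_real _).eq.symm
  · conv_lhs => enter [1, 1]; rw [← cfc_id ℝ A]
    rw [← cfc_mul _ _ A (hc _) (hc _)]
    conv_lhs => enter [2]; rw [← cfc_id ℝ A]
    rw [← cfc_mul _ _ A (hc _) (hc _)]
    conv_rhs => rw [← cfc_id ℝ A]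
    congr 1
    funext x
    exact mul_inv_mul_cancel x

lemma Matrix.IsHermitian.posSemidef_of_mul_self {ι : Type*} [Fintype ι]
    {P : Matrix ι ι ℂ} (hP : P.IsHermitian) (h : P * P = P) : P.PosSemidef := by
  have := posSemidef_conjTranspose_mul_self P
  rwa [hP.eq, h] at this

section Ensemble

variable {ι : Type*} [Fintype ι] [DecidableEq ι] {n : ℕ}

lemma IsPOVM.sum_re_trace_mul {M : Fin n → Matrix ι ι ℂ} (hM : IsPOVM M) {A : Matrix ι ι ℂ}
    (hA : A.trace = 1) : ∑ j, (A * M j).trace.re = 1 := by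
  rw [← Complex.re_sum, ← Matrix.trace_sum, ← Matrix.mul_sum, hM.2, Matrix.mul_one, hA,
    Complex.one_re]

lemma IsPOVM.re_trace_mul_nonneg {M : Fin n → Matrix ι ι ℂ} (hM : IsPOVM M) {A : Matrix ι ι ℂ}
    (hA : A.PosSemidef) (j : Fin n) : 0 ≤ (A * M j).trace.re :=
  (Complex.nonneg_iff.mp (hA.trace_mul_nonneg (hM.1 j))).1

lemma IsPOVM.re_trace_mul_le_one {M : Fin n → Matrix ι ι ℂ} (hM : IsPOVM M) {A : Matrix ι ι ℂ}
    (hA : A.PosSemidef) (hA1 : A.trace = 1) (i : Fin n) : (A * M i).trace.re ≤ 1 := by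
  rw [← hM.sum_re_trace_mul hA1]
  exact Finset.single_le_sum (fun j _ => hM.re_trace_mul_nonneg hA j) (Finset.mem_univ i)

lemma IsPOVM.mul_eq_zero_of_re_trace_mul_eq_one {M : Fin n → Matrix ι ι ℂ} (hM : IsPOVM M)
    {A : Matrix ι ι ℂ} (hA : A.PosSemidef) (hA1 : A.trace = 1) {i j : Fin n}
    (hi : (A * M i).trace.re = 1) (hij : i ≠ j) : A * M j = 0 := by
  refine hA.mul_eq_zero_of_re_trace_mul_eq_zero (hM.1 j) ?_
  have h := hM.sum_re_trace_mul hA1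
  rw [← Finset.add_sum_erase _ _ (Finset.mem_univ i), hi, add_eq_left,
    Finset.sum_eq_zero_iff_of_nonneg fun k _ => hM.re_trace_mul_nonneg hA k] at h
  exact h j (Finset.mem_erase.mpr ⟨hij.symm, Finset.mem_univ j⟩)

lemma IsPOVM.mul_eq_zero_of_forall_re_trace_mul_eq_one {M ρ : Fin n → Matrix ι ι ℂ}
    (hM : IsPOVM M) (hρ : ∀ i, (ρ i).PosSemidef ∧ (ρ i).trace = 1)
    (h : ∀ i, (ρ i * M i).trace.re = 1) {i j : Fin n} (hij : i ≠ j) : ρ i * ρ j = 0 := by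
  have hz {k l : Fin n} (hkl : k ≠ l) : ρ k * M l = 0 :=
    hM.mul_eq_zero_of_re_trace_mul_eq_one (hρ k).1 (hρ k).2 (h k) hkl
  have hi : ρ i * M i = ρ i := by
    rw [← Finset.sum_eq_single_of_mem (f := fun l => ρ i * M l) i (Finset.mem_univ i)
      fun l _ hl => hz hl.symm, ← Matrix.mul_sum, hM.2, Matrix.mul_one]
  have hj : M i * ρ j = 0 := by
    have := congrArg conjTranspose (hz hij.symm)
    rwa [conjTranspose_mul, (hM.1 i).isHermitian.eq, (hρ j).1.isHermitian.eq,
      conjTranspose_zero] at this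
  rw [← hi, Matrix.mul_assoc, hj, Matrix.mul_zero]

/-- Mutually orthogonal Hermitian matrices are separated by a POVM, built from the projections
onto their ranges. -/
lemma exists_isPOVM_mul_eq_self (hn : 1 ≤ n) {ρ : Fin n → Matrix ι ι ℂ}
    (hρ : ∀ i, (ρ i).IsHermitian) (h : ∀ i j, i ≠ j → ρ i * ρ j = 0) :
    ∃ M : Fin n → Matrix ι ι ℂ, IsPOVM M ∧ ∀ i, ρ i * M i = ρ i := by
  choose B hB hcomm hinv using fun i => (hρ i).exists_generalizedInverse
  set P : Fin n → Matrix ι ι ℂ := fun i => ρ i * B i with hPdef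
  have hPH (i) : (P i).IsHermitian := by
    rw [IsHermitian, conjTranspose_mul, (hB i).eq, (hρ i).eq, ← hcomm]
  have hPP (i) : P i * P i = P i := by
    simp only [hPdef]
    rw [← Matrix.mul_assoc, hinv]
  have hρP {i j} (hij : i ≠ j) : ρ i * P j = 0 := by
    simp only [hPdef]
    rw [← Matrix.mul_assoc, h i j hij, Matrix.zero_mul]
  have hρPs (i) : ρ i * P i = ρ i := by
    simp only [hPdef]
    rw [hcomm, ← Matrix.mul_assoc, hinv]
  have hPPne {i j} (hij : i ≠ j) : P i * P j = 0 := by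
    change ρ i * B i * P j = 0
    rw [hcomm, Matrix.mul_assoc, hρP hij, Matrix.mul_zero]
  set S := ∑ i, P i with hS
  have hSH : S.IsHermitian := by
    rw [IsHermitian, hS, conjTranspose_sum]
    exact Finset.sum_congr rfl fun i _ => (hPH i).eq
  have hPS (i) : P i * S = P i := by
    rw [hS, Matrix.mul_sum, Finset.sum_eq_single_of_mem i (Finset.mem_univ i)
      fun l _ hl => hPPne hl.symm, hPP]
  have hSS : S * S = S := by
    conv_lhs => enter [1]; rw [hS]
    rw [Matrix.sum_mul]
    exact Finset.sum_congr rfl fun i _ => hPS i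
  have hρS (i) : ρ i * S = ρ i := by
    rw [← hρPs i, Matrix.mul_assoc, hPS]
  have hR : (1 - S).PosSemidef := by
    refine (isHermitian_one.sub hSH).posSemidef_of_mul_self ?_
    rw [Matrix.mul_sub, Matrix.mul_one, Matrix.sub_mul, Matrix.one_mul, hSS, sub_self, sub_zero]
  refine ⟨fun i => P i + if i = ⟨0, hn⟩ then 1 - S else 0, ⟨fun i => ?_, ?_⟩, fun i => ?_⟩
  · refine ((hPH i).posSemidef_of_mul_self (hPP i)).add ?_
    split_ifs
    exacts [hR, PosSemidef.zero]
  · rw [Finset.sum_add_distrib, Finset.sum_ite_eq' Finset.univ, if_pos (Finset.mem_univ _),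
      ← hS, add_sub_cancel]
  · rw [Matrix.mul_add, hρPs]
    split_ifs
    · rw [Matrix.mul_sub, hρS, Matrix.mul_one, sub_self, add_zero]
    · rw [Matrix.mul_zero, add_zero]

end Ensemble

theorem stmt8 {ι : Type*} [Fintype ι] [DecidableEq ι] {n : ℕ} (hn : 1 ≤ n)
    (η : Fin n → ℝ) (ρ : Fin n → Matrix ι ι ℂ)
    (hη : ∀ i, 0 < η i) (hsum : ∑ i, η i = 1)
    (hρ : ∀ i, (ρ i).PosSemidef ∧ (ρ i).trace = 1) :
    ((∃ M : Fin n → Matrix ι ι ℂ, IsPOVM M ∧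
        ∑ i, η i * ((ρ i * M i).trace).re = 1)
      ↔ ∀ i j, i ≠ j → ρ i * ρ j = 0) ∧
    (∀ M : Fin n → Matrix ι ι ℂ, IsPOVM M →
      ∑ i, η i * ((ρ i * M i).trace).re ≤ 1) := by
  have hle {M : Fin n → Matrix ι ι ℂ} (hM : IsPOVM M) (i) :
      η i * (ρ i * M i).trace.re ≤ η i :=
    mul_le_of_le_one_right (hη i).le (hM.re_trace_mul_le_one (hρ i).1 (hρ i).2 i)
  refine ⟨⟨?_, fun h => ?_⟩, fun M hM => ?_⟩
  · rintro ⟨M, hM, h1⟩ i j hij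
    refine hM.mul_eq_zero_of_forall_re_trace_mul_eq_one hρ (fun k => ?_) hij
    have h := (Finset.sum_eq_sum_iff_of_le fun k _ => hle hM k).mp (h1.trans hsum.symm) k
      (Finset.mem_univ k)
    exact mul_left_cancel₀ (hη k).ne' (h.trans (mul_one _).symm)
  · obtain ⟨M, hM, hρM⟩ := exists_isPOVM_mul_eq_self hn (fun i => (hρ i).1.isHermitian) h
    refine ⟨M, hM, ?_⟩
    simpa [hρM, fun i => (hρ i).2] using hsum
  · rw [← hsum]
    exact Finset.sum_le_sum fun i _ => hle hM i
end

section
/- Let d, m ≥ 2 be integers and let G be the GHZ projector on the index type (Fin m → Fin d). Then for every subset S of Fin m with S nonempty and S ≠ Fin m, the partial transpose Γ_S(1 − 2•G) of the matrix 1 − 2•G (where 1 is the identity matrix) is positive semidefinite. -/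
open Matrix BigOperators
open scoped ComplexOrder

/-- The GHZ projector `|GHZ⟩⟨GHZ|` for `m` qudits of dimension `d`:
its `(x, y)` entry is `1/d` if `x` and `y` are both constant functions, and `0` otherwise. -/
noncomputable def ghz (d m : ℕ) : Matrix (Fin m → Fin d) (Fin m → Fin d) ℂ :=
  Matrix.of fun x y =>
    if (∃ a, ∀ k, x k = a) ∧ (∃ b, ∀ k, y k = b) then (1 / d : ℂ) else 0

/-- Partial transposition of an `m`-party matrix with respect to the set `S` of parties. -/
def ptS {d m : ℕ} (S : Finset (Fin m)) (ρ : Matrix (Fin m → Fin d) (Fin m → Fin d) ℂ) :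
    Matrix (Fin m → Fin d) (Fin m → Fin d) ℂ :=
  Matrix.of fun x y =>
    ρ (fun k => if k ∈ S then y k else x k) (fun k => if k ∈ S then x k else y k)

/-- If `σ` is an involution fixing every point outside `T` and `0 ≤ c ≤ 1`, then the identity minus
`c` times the permutation matrix of `σ` restricted to `T` is positive semidefinite. -/
theorem posSemidef_one_sub_smul_involution {n : Type*} [Fintype n] [DecidableEq n]
    (σ : n → n) (hσ : Function.Involutive σ) (T : n → Prop) [DecidablePred T]
    (hT : ∀ x, ¬ T x → σ x = x) (c : ℝ) (hc0 : 0 ≤ c) (hc1 : c ≤ 1) :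
    (Matrix.of fun x y => (if x = y then (1 : ℂ) else 0) -
      if T x ∧ σ x = y then (c : ℂ) else 0).PosSemidef := by
  set Q : Matrix n n ℂ := Matrix.of fun x y => if σ x = y then 1 else 0 with hQ
  set R : Matrix n n ℂ := Matrix.diagonal fun x => if T x then 0 else 1 with hR
  have hQH : Qᴴ = Q := by
    ext x y
    have : σ y = x ↔ σ x = y := ⟨fun h => h ▸ hσ y, fun h => h ▸ hσ x⟩
    simp only [hQ, Matrix.conjTranspose_apply, Matrix.of_apply, this]
    split_ifs <;> simp
  have hQQ : Q * Q = 1 := by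
    ext x y
    simp only [hQ, Matrix.mul_apply, Matrix.of_apply, ite_mul, one_mul, zero_mul,
      Finset.sum_ite_eq, Finset.mem_univ, if_true, hσ x, Matrix.one_apply]
  have hsq : (1 - Q)ᴴ * (1 - Q) = (2 : ℂ) • (1 - Q) := by
    rw [Matrix.conjTranspose_sub, hQH, Matrix.conjTranspose_one, sub_mul, mul_sub, mul_sub, hQQ,
      two_smul]
    simp only [one_mul, mul_one]
    abel
  have key : (Matrix.of fun x y => (if x = y then (1 : ℂ) else 0) -
      if T x ∧ σ x = y then (c : ℂ) else 0) =
      ((1 - c : ℝ) : ℂ) • (1 : Matrix n n ℂ) + (c : ℂ) • R +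
        ((c / 2 : ℝ) : ℂ) • ((1 - Q)ᴴ * (1 - Q)) := by
    rw [hsq]
    ext x y
    simp only [hQ, hR, Matrix.of_apply, Matrix.add_apply, Matrix.sub_apply, Matrix.smul_apply,
      Matrix.one_apply, Matrix.diagonal_apply, smul_eq_mul]
    push_cast
    have := hT x
    grind
  rw [key]
  refine ((Matrix.PosSemidef.one.smul ?_).add (Matrix.PosSemidef.smul ?_ ?_)).add
    ((Matrix.posSemidef_conjTranspose_mul_self _).smul ?_)
  · exact Complex.zero_le_real.mpr (by linarith)
  · refine Matrix.PosSemidef.diagonal fun x => ?_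
    by_cases h : T x <;> simp [h]
  · exact Complex.zero_le_real.mpr hc0
  · exact Complex.zero_le_real.mpr (by linarith)

theorem stmt12 (d m : ℕ) (hd : 2 ≤ d) (hm : 2 ≤ m)
    (S : Finset (Fin m)) (hS : S.Nonempty) (hS' : S ≠ Finset.univ) :
    (ptS S ((1 : Matrix (Fin m → Fin d) (Fin m → Fin d) ℂ) - (2 : ℂ) • ghz d m)).PosSemidef := by
  obtain ⟨s, hs⟩ := hS
  obtain ⟨t, ht⟩ : ∃ t, t ∉ S := by
    by_contra! h
    exact hS' (Finset.eq_univ_iff_forall.mpr h)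
  let T : (Fin m → Fin d) → Prop := fun x => ∀ k, x k = if k ∈ S then x s else x t
  let f : (Fin m → Fin d) → (Fin m → Fin d) := fun x k => if k ∈ S then x t else x s
  have hTf : ∀ x, T (f x) := fun x k => by simp [f, hs, ht]
  have hff : ∀ x, T x → f (f x) = x := fun x hx => by
    ext1 k
    rw [hx k]
    simp [f, hs, ht]
  have hd' : (2 : ℝ) ≤ d := by exact_mod_cast hd
  have hpsd := posSemidef_one_sub_smul_involution (fun x => if T x then f x else x)
    (fun x => by
      by_cases h : T x
      · simp [h, hTf x, hff x h]
      · simp [h])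
    T (fun x h => by simp [h]) (2 / d) (by positivity)
    ((div_le_one (by linarith)).mpr hd')
  convert hpsd using 1
  ext x y
  have h1 : ((fun k => if k ∈ S then y k else x k) = fun k => if k ∈ S then x k else y k) ↔
      x = y := by
    simp only [funext_iff]
    refine forall_congr' fun k => ?_
    by_cases hk : k ∈ S <;> simp [hk, eq_comm]
  have h2 : ((∃ a, ∀ k, (if k ∈ S then y k else x k) = a) ∧
      ∃ b, ∀ k, (if k ∈ S then x k else y k) = b) ↔
      T x ∧ (if T x then f x else x) = y := by
    constructor
    · rintro ⟨⟨a, ha⟩, b, hb⟩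
      have hTx : T x := fun k => by
        have := ha k; have := hb k; have := ha t; have := hb s
        grind
      refine ⟨hTx, ?_⟩
      rw [if_pos hTx]
      ext1 k
      have := ha k; have := hb k; have := ha t; have := hb s
      simp only [f]
      grind
    · rintro ⟨hTx, rfl⟩
      simp only [if_pos hTx]
      refine ⟨⟨x t, fun k => ?_⟩, x s, fun k => ?_⟩ <;>
      · have := hTx k
        simp only [f]
        grind
  simp only [ptS, ghz, Matrix.of_apply, Matrix.sub_apply, Matrix.smul_apply, Matrix.one_apply, h1,
    h2, smul_eq_mul]
  congr 1
  rw [mul_ite, mul_zero]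
  push_cast
  rw [mul_one_div]
end

section
/- Let d, m ≥ 2 be integers, let G be the GHZ projector on the index type (Fin m → Fin d), and consider the two-state ensemble γ0 = (d^m − 1)/d^m, τ0 = (1/(d^m − 1)) • (1 − G), γ1 = 1/d^m, τ1 = G (where 1 denotes the identity matrix). Then for every subset S of Fin m with S nonempty and S ≠ Fin m, the value (d^m − 1)/d^m is the greatest element of the set { γ0 * (Tr (Γ_S(τ0) * M 0)).re + γ1 * (Tr (Γ_S(τ1) * M 1)).re | M a POVM with 2 outcomes on (Fin m → Fin d) }. -/
open Matrix BigOperators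
open scoped ComplexOrder

/-- Twice the real part of an off-diagonal entry of a positive semidefinite matrix is at most
the sum of the corresponding diagonal entries. -/
theorem Matrix.PosSemidef.two_mul_re_apply_le {ι : Type*} [Fintype ι] [DecidableEq ι]
    {M : Matrix ι ι ℂ} (hM : M.PosSemidef) (x y : ι) :
    2 * (M x y).re ≤ (M x x).re + (M y y).re := by
  have h := hM.dotProduct_mulVec_nonneg (Pi.single x 1 - Pi.single y 1)
  have hre := (Complex.le_def.1 h).1
  have hsymm : (M y x).re = (M x y).re := by
    rw [← hM.isHermitian.apply x y]
    simp
  simp [Matrix.mulVec_sub, sub_dotProduct, dotProduct_sub, Matrix.mulVec_single] at hre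
  linarith

/-- A symmetric, entrywise nonnegative real kernel whose row sums are at most `c` pairs with a
positive semidefinite matrix to at most `c` times the trace. -/
theorem Matrix.PosSemidef.sum_mul_re_le {ι : Type*} [Fintype ι] [DecidableEq ι]
    {M : Matrix ι ι ℂ} (hM : M.PosSemidef) {h : ι → ι → ℝ} {c : ℝ}
    (h0 : ∀ x y, 0 ≤ h x y) (hsymm : ∀ x y, h x y = h y x) (hrow : ∀ x, ∑ y, h x y ≤ c) :
    ∑ x, ∑ y, h x y * (M y x).re ≤ c * ∑ x, (M x x).re := by
  have key : ∑ x, ∑ y, h x y * (M y x).re ≤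
      ∑ x, ∑ y, (h x y * (M x x).re / 2 + h x y * (M y y).re / 2) := by
    refine Finset.sum_le_sum fun x _ => Finset.sum_le_sum fun y _ => ?_
    nlinarith [mul_le_mul_of_nonneg_left (hM.two_mul_re_apply_le y x) (h0 x y)]
  have hswap : ∑ x, ∑ y, h x y * (M y y).re / 2 = ∑ x, ∑ y, h x y * (M x x).re / 2 := by
    rw [Finset.sum_comm]
    exact Finset.sum_congr rfl fun x _ => Finset.sum_congr rfl fun y _ => by rw [hsymm y x]
  refine key.trans ?_
  simp_rw [Finset.sum_add_distrib]
  rw [hswap, ← Finset.sum_add_distrib, Finset.mul_sum]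
  refine Finset.sum_le_sum fun x _ => ?_
  have hdiag : 0 ≤ (M x x).re := (Complex.le_def.1 (hM.diag_nonneg (i := x))).1
  rw [← Finset.sum_div, ← Finset.sum_mul]
  nlinarith [mul_le_mul_of_nonneg_right (hrow x) hdiag]

theorem ptS_ghz_eq_ofReal {d m : ℕ} (S : Finset (Fin m)) (x y : Fin m → Fin d) :
    ptS S (ghz d m) x y = ((ptS S (ghz d m) x y).re : ℂ) := by
  simp only [ptS, ghz, Matrix.of_apply]
  split_ifs <;> simp

theorem ptS_ghz_re_nonneg {d m : ℕ} (S : Finset (Fin m)) (x y : Fin m → Fin d) :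
    0 ≤ (ptS S (ghz d m) x y).re := by
  simp only [ptS, ghz, Matrix.of_apply]
  split_ifs
  · rw [← Complex.ofReal_natCast, ← Complex.ofReal_one, ← Complex.ofReal_div, Complex.ofReal_re]
    positivity
  · simp

theorem ptS_ghz_re_le {d m : ℕ} (S : Finset (Fin m)) (x y : Fin m → Fin d) :
    (ptS S (ghz d m) x y).re ≤ 1 / d := by
  simp only [ptS, ghz, Matrix.of_apply]
  split_ifs
  · rw [← Complex.ofReal_natCast, ← Complex.ofReal_one, ← Complex.ofReal_div, Complex.ofReal_re]
  · simp

theorem ptS_ghz_symm {d m : ℕ} (S : Finset (Fin m)) (x y : Fin m → Fin d) :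
    ptS S (ghz d m) x y = ptS S (ghz d m) y x := by
  simp only [ptS, ghz, Matrix.of_apply]
  exact if_congr and_comm rfl rfl

theorem sum_ptS_ghz_re_le {d m : ℕ} {S : Finset (Fin m)} (hS : S.Nonempty)
    (hS' : S ≠ Finset.univ) (x : Fin m → Fin d) :
    ∑ y, (ptS S (ghz d m) x y).re ≤ 1 / d := by
  obtain ⟨i, hi⟩ := hS
  obtain ⟨j, hj⟩ : ∃ j, j ∉ S := by
    by_contra! h
    exact hS' (Finset.eq_univ_iff_forall.2 h)
  rw [Finset.sum_eq_single (fun k => if k ∈ S then x j else x i)]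
  · exact ptS_ghz_re_le S x _
  · intro y _ hy
    simp only [ptS, ghz, Matrix.of_apply]
    rw [if_neg, Complex.zero_re]
    rintro ⟨⟨a, ha⟩, b, hb⟩
    refine hy (funext fun k => ?_)
    have haj := ha j
    have hbi := hb i
    have hak := ha k
    have hbk := hb k
    simp only [hi, hj, if_true, if_false] at haj hbi
    by_cases hk : k ∈ S <;> simp only [hk, if_true, if_false] at hak hbk ⊢
    · rw [hak, haj]
    · rw [hbk, hbi]
  · simp

theorem trace_ptS_ghz {d m : ℕ} (hd : d ≠ 0) (hm : m ≠ 0) (S : Finset (Fin m)) :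
    (ptS S (ghz d m)).trace = 1 := by
  classical
  have : Nonempty (Fin m) := ⟨⟨0, Nat.pos_of_ne_zero hm⟩⟩
  have himg : (Finset.univ.filter fun x : Fin m → Fin d => ∃ a, ∀ k, x k = a) =
      Finset.univ.image (Function.const (Fin m)) := by
    ext x
    simp [funext_iff, eq_comm]
  simp only [Matrix.trace, Matrix.diag, ptS, ghz, Matrix.of_apply, ite_self, and_self]
  rw [← Finset.sum_filter, Finset.sum_const, himg,
    Finset.card_image_of_injective _ Function.const_injective]
  simp [hd]

theorem trace_ptS_ghz_mul_re_le {d m : ℕ} {S : Finset (Fin m)} (hS : S.Nonempty)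
    (hS' : S ≠ Finset.univ) {M : Matrix (Fin m → Fin d) (Fin m → Fin d) ℂ}
    (hM : M.PosSemidef) :
    ((ptS S (ghz d m) * M).trace).re ≤ 1 / d * (M.trace).re := by
  have h := hM.sum_mul_re_le (ptS_ghz_re_nonneg S)
    (fun x y => congrArg Complex.re (ptS_ghz_symm S x y)) (sum_ptS_ghz_re_le hS hS')
  simp only [Matrix.trace, Matrix.diag, Matrix.mul_apply, Complex.re_sum]
  refine le_of_eq_of_le (Finset.sum_congr rfl fun x _ => Finset.sum_congr rfl fun y _ => ?_) h
  rw [ptS_ghz_eq_ofReal, Complex.re_ofReal_mul, Complex.ofReal_re]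

theorem ptS_smul_one_sub {d m : ℕ} (S : Finset (Fin m)) (c : ℝ)
    (ρ : Matrix (Fin m → Fin d) (Fin m → Fin d) ℂ) :
    ptS S (c • (1 - ρ)) = c • (1 - ptS S ρ) := by
  ext x y
  have h : (fun k => if k ∈ S then y k else x k) = (fun k => if k ∈ S then x k else y k) ↔
      x = y := by
    simp only [funext_iff]
    refine forall_congr' fun k => ?_
    split_ifs
    · exact eq_comm
    · rfl
  simp only [ptS, Matrix.of_apply, Matrix.smul_apply, Matrix.sub_apply, Matrix.one_apply, h]

theorem stmt13 (d m : ℕ) (hd : 2 ≤ d) (hm : 2 ≤ m)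
    (S : Finset (Fin m)) (hS : S.Nonempty) (hS' : S ≠ Finset.univ) :
    IsGreatest
      {x : ℝ | ∃ M : Fin 2 → Matrix (Fin m → Fin d) (Fin m → Fin d) ℂ, IsPOVM M ∧
        x = ((d : ℝ) ^ m - 1) / (d : ℝ) ^ m *
              ((ptS S (((d : ℝ) ^ m - 1)⁻¹ •
                ((1 : Matrix (Fin m → Fin d) (Fin m → Fin d) ℂ) - ghz d m)) * M 0).trace).re
          + 1 / (d : ℝ) ^ m * ((ptS S (ghz d m) * M 1).trace).re}
      (((d : ℝ) ^ m - 1) / (d : ℝ) ^ m) := by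
  have hd' : (2 : ℝ) ≤ d := by exact_mod_cast hd
  have hD : (0 : ℝ) < (d : ℝ) ^ m := by positivity
  have hD1 : (d : ℝ) ^ m - 1 ≠ 0 := by
    have := one_lt_pow₀ (show (1 : ℝ) < d by linarith) (show m ≠ 0 by omega)
    linarith
  have value (M : Fin 2 → Matrix (Fin m → Fin d) (Fin m → Fin d) ℂ) (hM : IsPOVM M) :
      ((d : ℝ) ^ m - 1) / (d : ℝ) ^ m *
              ((ptS S (((d : ℝ) ^ m - 1)⁻¹ •
                ((1 : Matrix (Fin m → Fin d) (Fin m → Fin d) ℂ) - ghz d m)) * M 0).trace).re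
          + 1 / (d : ℝ) ^ m * ((ptS S (ghz d m) * M 1).trace).re =
        ((d : ℝ) ^ m - 1 - ((M 1).trace.re - 2 * ((ptS S (ghz d m) * M 1).trace).re)) /
          (d : ℝ) ^ m := by
    have h0 : M 0 = 1 - M 1 := by
      rw [← hM.2, Fin.sum_univ_two, add_sub_cancel_right]
    have htr : ((1 : Matrix (Fin m → Fin d) (Fin m → Fin d) ℂ).trace).re = (d : ℝ) ^ m := by
      rw [Matrix.trace_one, Complex.natCast_re]
      simp
    rw [ptS_smul_one_sub, h0, Matrix.smul_mul, Matrix.trace_smul, Complex.smul_re, smul_eq_mul,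
      sub_mul, mul_sub, mul_sub, one_mul, one_mul, mul_one]
    simp only [Matrix.trace_sub, Complex.sub_re, htr,
      trace_ptS_ghz (show d ≠ 0 by omega) (show m ≠ 0 by omega) S, Complex.one_re]
    field_simp
    ring
  constructor
  · have hM : IsPOVM ![(1 : Matrix (Fin m → Fin d) (Fin m → Fin d) ℂ), 0] := by
      refine ⟨fun i => ?_, by simp⟩
      fin_cases i
      · exact Matrix.PosSemidef.one
      · exact Matrix.PosSemidef.zero
    refine ⟨_, hM, ?_⟩
    rw [value _ hM]
    simp
  · rintro x ⟨M, hM, rfl⟩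
    rw [value M hM]
    have hle := trace_ptS_ghz_mul_re_le hS hS' (hM.1 1)
    have htr : 0 ≤ (M 1).trace.re := (Complex.le_def.1 (hM.1 1).trace_nonneg).1
    have hhalf : 1 / (d : ℝ) ≤ 1 / 2 := one_div_le_one_div_of_le (by norm_num) hd'
    refine div_le_div_of_nonneg_right ?_ hD.le
    nlinarith [mul_le_mul_of_nonneg_right hhalf htr]
end

section
/- Let d, m ≥ 2 and s ≥ 1 be integers, let G be the GHZ projector on (Fin m → Fin d), and let N = 1 − 2•G. On the index type (Fin s → (Fin m → Fin d)) let Π_1 be the s-fold tensor power of N, i.e., Π_1 x y = ∏ l, N (x l) (y l), and let Π_0 = 1 (the identity). Define σ_0 = (1/(d^{ms} + (d^m − 2)^s)) • (Π_0 + Π_1) and σ_1 = (1/(d^{ms} − (d^m − 2)^s)) • (Π_0 − Π_1). Then σ_0 and σ_1 are density matrices (positive semidefinite with trace 1) and σ_0 * σ_1 = 0. -/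
open Matrix BigOperators
open scoped ComplexOrder

/-- The `s`-fold tensor power `Π₁ = (1 - 2|GHZ⟩⟨GHZ|)^{⊗ s}`. -/
noncomputable def piOne (d m s : ℕ) :
    Matrix (Fin s → Fin m → Fin d) (Fin s → Fin m → Fin d) ℂ :=
  Matrix.of fun x y =>
    ∏ l, ((1 : Matrix (Fin m → Fin d) (Fin m → Fin d) ℂ) - (2 : ℂ) • ghz d m) (x l) (y l)

/-- The `s`-fold tensor power of a square matrix, indexed by families of indices. -/
def tensorPow {n R : Type*} [CommRing R] (s : ℕ) (A : Matrix n n R) :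
    Matrix (Fin s → n) (Fin s → n) R :=
  Matrix.of fun x y => ∏ l, A (x l) (y l)

section TensorPow

variable {n R : Type*} [CommRing R]

theorem tensorPow_one [DecidableEq n] (s : ℕ) : tensorPow s (1 : Matrix n n R) = 1 := by
  ext x y
  simp only [tensorPow, Matrix.of_apply, Matrix.one_apply, Finset.prod_ite_zero, funext_iff,
    Finset.mem_univ, true_imp_iff, Finset.prod_const_one]

theorem tensorPow_mul [Fintype n] (s : ℕ) (A B : Matrix n n R) :
    tensorPow s (A * B) = tensorPow s A * tensorPow s B := by
  ext x y
  simp only [tensorPow, Matrix.of_apply, Matrix.mul_apply, Finset.prod_univ_sum,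
    Fintype.piFinset_univ, Finset.prod_mul_distrib]

theorem trace_tensorPow [Fintype n] (s : ℕ) (A : Matrix n n R) :
    (tensorPow s A).trace = A.trace ^ s := by
  have h := Finset.prod_univ_sum (fun _ : Fin s => (Finset.univ : Finset n)) fun _ j => A j j
  rw [Fintype.piFinset_univ, Finset.prod_const, Finset.card_univ, Fintype.card_fin] at h
  exact h.symm

theorem isHermitian_tensorPow [StarRing R] (s : ℕ) {A : Matrix n n R} (hA : A.IsHermitian) :
    (tensorPow s A).IsHermitian := by
  ext x y
  simp only [tensorPow, Matrix.conjTranspose_apply, Matrix.of_apply, star_prod, hA.apply]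

end TensorPow

section Involution

variable {n : Type*} [Fintype n] [DecidableEq n] {P : Matrix n n ℂ}

theorem posSemidef_one_add_of_involution (hP : P.IsHermitian) (hPP : P * P = 1) :
    (1 + P).PosSemidef := by
  have h : 1 + P = (2⁻¹ : ℝ) • ((1 + P)ᴴ * (1 + P)) := by
    rw [Matrix.conjTranspose_add, Matrix.conjTranspose_one, hP.eq, mul_add, add_mul, add_mul, hPP]
    simp only [mul_one, one_mul]
    module
  rw [h]
  exact (Matrix.posSemidef_conjTranspose_mul_self _).smul (by norm_num)

theorem posSemidef_one_sub_of_involution (hP : P.IsHermitian) (hPP : P * P = 1) :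
    (1 - P).PosSemidef := by
  rw [sub_eq_add_neg]
  exact posSemidef_one_add_of_involution hP.neg (by rw [neg_mul_neg, hPP])

end Involution

/-- The unnormalized GHZ vector: the indicator of the constant functions. -/
noncomputable def ghzVec (d m : ℕ) : (Fin m → Fin d) → ℂ :=
  fun x => if ∃ a, ∀ k, x k = a then 1 else 0

theorem ghz_eq_smul_vecMulVec (d m : ℕ) :
    ghz d m = (d : ℂ)⁻¹ • Matrix.vecMulVec (ghzVec d m) (ghzVec d m) := by
  ext x y
  simp only [ghz, ghzVec, Matrix.of_apply, Matrix.smul_apply, Matrix.vecMulVec_apply, ite_and]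
  split_ifs <;> simp

theorem ghzVec_dotProduct_self (d : ℕ) {m : ℕ} (hm : m ≠ 0) :
    ghzVec d m ⬝ᵥ ghzVec d m = d := by
  have : NeZero m := ⟨hm⟩
  have hcard : (Finset.univ.filter fun x : Fin m → Fin d => ∃ a, ∀ k, x k = a) =
      Finset.univ.image fun (a : Fin d) (_ : Fin m) => a := by
    ext x
    simp only [Finset.mem_filter, Finset.mem_univ, true_and, Finset.mem_image, funext_iff, eq_comm]
  have hinj : Function.Injective fun (a : Fin d) (_ : Fin m) => a := fun a b h => congrFun h 0
  simp only [dotProduct, ghzVec, mul_ite, mul_one, mul_zero, ← ite_and, and_self]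
  rw [Finset.sum_boole, hcard, Finset.card_image_of_injective _ hinj, Finset.card_univ,
    Fintype.card_fin]

theorem isHermitian_ghz (d m : ℕ) : (ghz d m).IsHermitian := by
  ext x y
  simp only [ghz, Matrix.conjTranspose_apply, Matrix.of_apply, and_comm, apply_ite star]
  simp

theorem ghz_mul_self {d m : ℕ} (hd : d ≠ 0) (hm : m ≠ 0) : ghz d m * ghz d m = ghz d m := by
  have hd' : (d : ℂ) ≠ 0 := Nat.cast_ne_zero.mpr hd
  rw [ghz_eq_smul_vecMulVec, Matrix.smul_mul, Matrix.mul_smul, Matrix.vecMulVec_mul_vecMulVec,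
    ghzVec_dotProduct_self d hm, Matrix.vecMulVec_smul, inv_smul_smul₀ hd']

theorem trace_ghz {d m : ℕ} (hd : d ≠ 0) (hm : m ≠ 0) : (ghz d m).trace = 1 := by
  rw [ghz_eq_smul_vecMulVec, Matrix.trace_smul, Matrix.trace_vecMulVec,
    ghzVec_dotProduct_self d hm, smul_eq_mul, inv_mul_cancel₀ (Nat.cast_ne_zero.mpr hd)]

theorem piOne_eq_tensorPow (d m s : ℕ) : piOne d m s = tensorPow s (1 - (2 : ℂ) • ghz d m) := rfl

theorem isHermitian_piOne (d m s : ℕ) : (piOne d m s).IsHermitian :=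
  isHermitian_tensorPow s <| Matrix.isHermitian_one.sub <| by
    rw [Matrix.IsHermitian, Matrix.conjTranspose_smul, (isHermitian_ghz d m).eq, star_ofNat]

theorem piOne_mul_self {d m : ℕ} (hd : d ≠ 0) (hm : m ≠ 0) (s : ℕ) :
    piOne d m s * piOne d m s = 1 := by
  have h : (1 - (2 : ℂ) • ghz d m) * (1 - (2 : ℂ) • ghz d m) = 1 := by
    rw [mul_sub, sub_mul, sub_mul, Matrix.smul_mul, Matrix.smul_mul, Matrix.mul_smul,
      Matrix.mul_smul, ghz_mul_self hd hm, mul_one, mul_one, one_mul]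
    module
  rw [piOne_eq_tensorPow, ← tensorPow_mul, h, tensorPow_one]

theorem trace_piOne {d m : ℕ} (hd : d ≠ 0) (hm : m ≠ 0) (s : ℕ) :
    (piOne d m s).trace = ((d : ℂ) ^ m - 2) ^ s := by
  rw [piOne_eq_tensorPow, trace_tensorPow, Matrix.trace_sub, Matrix.trace_smul, trace_ghz hd hm,
    Matrix.trace_one]
  simp

theorem stmt14 (d m s : ℕ) (hd : 2 ≤ d) (hm : 2 ≤ m) (hs : 1 ≤ s) :
    (((d : ℝ) ^ (m * s) + ((d : ℝ) ^ m - 2) ^ s)⁻¹ •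
        ((1 : Matrix (Fin s → Fin m → Fin d) (Fin s → Fin m → Fin d) ℂ) + piOne d m s)).PosSemidef
    ∧ (((d : ℝ) ^ (m * s) + ((d : ℝ) ^ m - 2) ^ s)⁻¹ •
        ((1 : Matrix (Fin s → Fin m → Fin d) (Fin s → Fin m → Fin d) ℂ) + piOne d m s)).trace = 1
    ∧ (((d : ℝ) ^ (m * s) - ((d : ℝ) ^ m - 2) ^ s)⁻¹ •
        ((1 : Matrix (Fin s → Fin m → Fin d) (Fin s → Fin m → Fin d) ℂ) - piOne d m s)).PosSemidef
    ∧ (((d : ℝ) ^ (m * s) - ((d : ℝ) ^ m - 2) ^ s)⁻¹ •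
        ((1 : Matrix (Fin s → Fin m → Fin d) (Fin s → Fin m → Fin d) ℂ) - piOne d m s)).trace = 1
    ∧ (((d : ℝ) ^ (m * s) + ((d : ℝ) ^ m - 2) ^ s)⁻¹ •
        ((1 : Matrix (Fin s → Fin m → Fin d) (Fin s → Fin m → Fin d) ℂ) + piOne d m s)) *
      (((d : ℝ) ^ (m * s) - ((d : ℝ) ^ m - 2) ^ s)⁻¹ •
        ((1 : Matrix (Fin s → Fin m → Fin d) (Fin s → Fin m → Fin d) ℂ) - piOne d m s)) = 0 := by
  have hd0 : d ≠ 0 := by omega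
  have hm0 : m ≠ 0 := by omega
  have hherm := isHermitian_piOne d m s
  have hsq := piOne_mul_self hd0 hm0 s
  have hdm : (2 : ℝ) ≤ (d : ℝ) ^ m :=
    (Nat.ofNat_le_cast.mpr hd).trans
      (le_self_pow₀ (Nat.one_le_cast.mpr (by omega)) hm0)
  have hnonneg : 0 ≤ ((d : ℝ) ^ m - 2) ^ s := pow_nonneg (by linarith) s
  have hlt : ((d : ℝ) ^ m - 2) ^ s < (d : ℝ) ^ (m * s) := by
    rw [pow_mul]
    exact pow_lt_pow_left₀ (by linarith) (by linarith) (by omega)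
  have htr_one : (1 : Matrix (Fin s → Fin m → Fin d) (Fin s → Fin m → Fin d) ℂ).trace =
      (((d : ℝ) ^ (m * s) : ℝ) : ℂ) := by
    rw [Matrix.trace_one]
    simp [pow_mul]
  have htr_pi : (piOne d m s).trace = ((((d : ℝ) ^ m - 2) ^ s : ℝ) : ℂ) := by
    rw [trace_piOne hd0 hm0]
    push_cast
    rfl
  refine ⟨(posSemidef_one_add_of_involution hherm hsq).smul (inv_nonneg.mpr (by linarith)), ?_,
    (posSemidef_one_sub_of_involution hherm hsq).smul (inv_nonneg.mpr (by linarith)), ?_, ?_⟩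
  · rw [Matrix.trace_smul, Matrix.trace_add, htr_one, htr_pi, ← Complex.ofReal_add,
      Complex.real_smul, ← Complex.ofReal_mul, inv_mul_cancel₀ (by linarith), Complex.ofReal_one]
  · rw [Matrix.trace_smul, Matrix.trace_sub, htr_one, htr_pi, ← Complex.ofReal_sub,
      Complex.real_smul, ← Complex.ofReal_mul, inv_mul_cancel₀ (by linarith), Complex.ofReal_one]
  · have h : (1 + piOne d m s) * (1 - piOne d m s) = 0 := by
      rw [mul_sub, add_mul, add_mul, hsq]
      simp only [mul_one, one_mul]
      abel
    rw [Matrix.smul_mul, Matrix.mul_smul, h, smul_zero, smul_zero]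
end

section
/- Let d, m ≥ 2 and s ≥ 1 be integers, let G be the GHZ projector on (Fin m → Fin d), and let N = 1 − 2•G. On the index type (Fin s → (Fin m → Fin d)) let Π_1 be the s-fold tensor power of N, i.e., Π_1 x y = ∏ l, N (x l) (y l). Then for every subset S of Fin m with S nonempty and S ≠ Fin m, the partial transpose Γ_S(Π_1) is positive semidefinite, where Γ_S acts by Γ_S(ρ) x y = ρ x' y' with, for each l ∈ Fin s, (x' l) k = (y l) k and (y' l) k = (x l) k if k ∈ S, and (x' l) k = (x l) k, (y' l) k = (y l) k if k ∉ S. -/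
open Matrix BigOperators
open scoped ComplexOrder

/-- Partial transposition with respect to the parties in `S`, acting simultaneously on all
`s` GHZ-factors. -/
def ptS2 {d m s : ℕ} (S : Finset (Fin m))
    (ρ : Matrix (Fin s → Fin m → Fin d) (Fin s → Fin m → Fin d) ℂ) :
    Matrix (Fin s → Fin m → Fin d) (Fin s → Fin m → Fin d) ℂ :=
  Matrix.of fun x y =>
    ρ (fun l k => if k ∈ S then y l k else x l k) (fun l k => if k ∈ S then x l k else y l k)

open scoped MatrixOrder in
/-- A tensor power of a positive semidefinite matrix is positive semidefinite. -/
theorem Matrix.PosSemidef.tensorPower {ι κ : Type*} [Fintype ι] [Fintype κ]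
    {M : Matrix ι ι ℂ} (hM : M.PosSemidef) :
    (Matrix.of fun x y : κ → ι => ∏ l, M (x l) (y l)).PosSemidef := by
  classical
  obtain ⟨B, rfl⟩ := CStarAlgebra.nonneg_iff_eq_star_mul_self.mp hM.nonneg
  rw [Matrix.star_eq_conjTranspose]
  convert Matrix.posSemidef_conjTranspose_mul_self
    (Matrix.of fun z x : κ → ι => ∏ l, B (z l) (x l)) using 1
  ext x y
  simp [Matrix.mul_apply, Finset.prod_univ_sum, Finset.prod_mul_distrib]

/-- The adjacency matrix of the pairs exchanged by a self-map `σ`; fixed points are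
paired with themselves. -/
def exchangeMatrix {ι : Type*} [DecidableEq ι] (σ : ι → ι) : Matrix ι ι ℂ :=
  Matrix.of fun x y => if σ x = y ∧ σ y = x then 1 else 0

theorem exchangeMatrix_conjTranspose {ι : Type*} [DecidableEq ι] (σ : ι → ι) :
    (exchangeMatrix σ)ᴴ = exchangeMatrix σ := by
  ext x y
  simp [exchangeMatrix, Matrix.conjTranspose_apply, and_comm, apply_ite]

theorem exchangeMatrix_mul_self {ι : Type*} [Fintype ι] [DecidableEq ι] (σ : ι → ι) :
    exchangeMatrix σ * exchangeMatrix σ =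
      Matrix.diagonal fun x => if σ (σ x) = x then 1 else 0 := by
  ext x y
  rw [Matrix.mul_apply, Finset.sum_eq_single (σ x)]
  · simp only [exchangeMatrix, Matrix.of_apply, Matrix.diagonal_apply]
    grind
  · intro z _ hz
    simp [exchangeMatrix, hz.symm]
  · simp

theorem posSemidef_one_sub_exchangeMatrix {ι : Type*} [Fintype ι] [DecidableEq ι]
    (σ : ι → ι) : (1 - exchangeMatrix σ).PosSemidef := by
  have hdiag : (1 - exchangeMatrix σ * exchangeMatrix σ).PosSemidef := by
    rw [exchangeMatrix_mul_self, ← Matrix.diagonal_one, Matrix.diagonal_sub,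
      Matrix.posSemidef_diagonal_iff]
    intro x
    split_ifs <;> simp
  have hsq := Matrix.posSemidef_conjTranspose_mul_self (1 - exchangeMatrix σ)
  rw [Matrix.conjTranspose_sub, Matrix.conjTranspose_one,
    exchangeMatrix_conjTranspose] at hsq
  have h := (hsq.add hdiag).smul (show (0 : ℂ) ≤ 1 / 2 by positivity)
  convert h using 1
  rw [sub_mul, mul_sub, mul_sub, one_mul, one_mul, mul_one]
  module

/-- The self-map of `Fin m → Fin d` for which `(a on S, b off S)` and `(b on S, a off S)`
are exchanged, where `p ∈ S` and `q ∉ S`. -/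
def swapBlocks {d m : ℕ} (S : Finset (Fin m)) (p q : Fin m) (x : Fin m → Fin d) :
    Fin m → Fin d :=
  fun k => if k ∈ S then x q else x p

theorem partialTranspose_ghz_apply {d m : ℕ} {S : Finset (Fin m)} {p q : Fin m}
    (hp : p ∈ S) (hq : q ∉ S) (x y : Fin m → Fin d) :
    ghz d m (fun k => if k ∈ S then y k else x k) (fun k => if k ∈ S then x k else y k) =
      (1 / d : ℂ) * exchangeMatrix (swapBlocks S p q) x y := by
  have key : ((∃ a, ∀ k, (if k ∈ S then y k else x k) = a) ∧
      (∃ b, ∀ k, (if k ∈ S then x k else y k) = b)) ↔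
      (swapBlocks S p q x = y ∧ swapBlocks S p q y = x) := by
    simp only [funext_iff, swapBlocks]
    constructor
    · rintro ⟨⟨a, ha⟩, b, hb⟩
      constructor <;> intro k <;> grind
    · rintro ⟨h₁, h₂⟩
      refine ⟨⟨x q, fun k => ?_⟩, x p, fun k => ?_⟩ <;> grind
  simp only [ghz, exchangeMatrix, Matrix.of_apply, key]
  split_ifs <;> simp

theorem partialTranspose_one_apply {ι α : Type*} [DecidableEq ι] [Fintype ι] [DecidableEq α]
    (S : Finset ι) (x y : ι → α) :
    (1 : Matrix (ι → α) (ι → α) ℂ) (fun k => if k ∈ S then y k else x k)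
      (fun k => if k ∈ S then x k else y k) = (1 : Matrix (ι → α) (ι → α) ℂ) x y := by
  simp only [Matrix.one_apply, funext_iff]
  congr 1
  grind

theorem posSemidef_one_sub_smul_exchangeMatrix {ι : Type*} [Fintype ι] [DecidableEq ι]
    (σ : ι → ι) {d : ℕ} (hd : 2 ≤ d) :
    (1 - (2 / d : ℂ) • exchangeMatrix σ).PosSemidef := by
  have hc : (0 : ℂ) ≤ 1 - 2 / d := by
    have h : (0 : ℝ) ≤ 1 - 2 / d := by
      rw [sub_nonneg, div_le_one (by positivity)]
      exact_mod_cast hd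
    simpa using Complex.zero_le_real.2 h
  have h := (Matrix.PosSemidef.one.smul hc).add
    ((posSemidef_one_sub_exchangeMatrix σ).smul (show (0 : ℂ) ≤ 2 / d by positivity))
  convert h using 1
  module

theorem stmt15 (d m s : ℕ) (hd : 2 ≤ d) (hm : 2 ≤ m) (hs : 1 ≤ s)
    (S : Finset (Fin m)) (hS : S.Nonempty) (hS' : S ≠ Finset.univ) :
    (ptS2 S (piOne d m s)).PosSemidef := by
  obtain ⟨p, hp⟩ := hS
  obtain ⟨q, hq⟩ : ∃ q, q ∉ S := by simpa [Finset.eq_univ_iff_forall] using hS'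
  convert (posSemidef_one_sub_smul_exchangeMatrix
    (swapBlocks (d := d) S p q) hd).tensorPower (κ := Fin s) using 1
  ext x y
  simp only [ptS2, piOne, Matrix.of_apply, Matrix.sub_apply, Matrix.smul_apply, smul_eq_mul,
    partialTranspose_one_apply, partialTranspose_ghz_apply hp hq]
  exact Finset.prod_congr rfl fun l _ => by ring
end

section
/- Let d, m ≥ 2 and s, t ≥ 1 be integers and set n = 2^t. With λ_0 = (d^{ms} + (d^m − 2)^s)/(2 d^{ms}), λ_1 = (d^{ms} − (d^m − 2)^s)/(2 d^{ms}) and the density matrices σ_0, σ_1 on (Fin s → (Fin m → Fin d)) as defined below, for i ∈ Fin n let b_k(i) ∈ Fin 2 (for k ∈ Fin t) be the binary digits of i (so that ∑ k, (b_k(i)).val * 2^k = i.val), and define η_i = ∏ k, λ_{b_k(i)} and ρ_i as the t-fold tensor product on the index type (Fin t → Fin s → (Fin m → Fin d)) with entries ρ_i x y = ∏ k, σ_{b_k(i)} (x k) (y k). Then for every subset S of Fin m with S nonempty and S ≠ Fin m and every i ∈ Fin n, the matrix η_0 • Γ_S(ρ_0) − η_i • Γ_S(ρ_i) is positive semidefinite,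 where Γ_S transposes the S-coordinates in every one of the t·s GHZ-factors: Γ_S(ρ) x y = ρ x' y' with, for each k ∈ Fin t and l ∈ Fin s, (x' k l) j = (y k l) j and (y' k l) j = (x k l) j if j ∈ S, and (x' k l) j = (x k l) j, (y' k l) j = (y k l) j if j ∉ S. -/
open Matrix BigOperators
open scoped ComplexOrder

/-- The pair of mutually orthogonal states `σ₀, σ₁` built from `Π₀ = 1` and `Π₁`. -/
noncomputable def sig (d m s : ℕ) :
    Fin 2 → Matrix (Fin s → Fin m → Fin d) (Fin s → Fin m → Fin d) ℂ :=
  ![((d : ℝ) ^ (m * s) + ((d : ℝ) ^ m - 2) ^ s)⁻¹ •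
      ((1 : Matrix (Fin s → Fin m → Fin d) (Fin s → Fin m → Fin d) ℂ) + piOne d m s),
    ((d : ℝ) ^ (m * s) - ((d : ℝ) ^ m - 2) ^ s)⁻¹ •
      ((1 : Matrix (Fin s → Fin m → Fin d) (Fin s → Fin m → Fin d) ℂ) - piOne d m s)]

/-- The corresponding probabilities `λ₀, λ₁`. -/
noncomputable def lam (d m s : ℕ) : Fin 2 → ℝ :=
  ![((d : ℝ) ^ (m * s) + ((d : ℝ) ^ m - 2) ^ s) / (2 * (d : ℝ) ^ (m * s)),
    ((d : ℝ) ^ (m * s) - ((d : ℝ) ^ m - 2) ^ s) / (2 * (d : ℝ) ^ (m * s))]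

/-- The `k`-th binary digit of `i`, so that `∑ k, (bdig i k).val * 2 ^ k = i.val` when
`i < 2 ^ t`. -/
def bdig {n t : ℕ} (i : Fin n) (k : Fin t) : Fin 2 :=
  ⟨i.val / 2 ^ (k : ℕ) % 2, Nat.mod_lt _ (by norm_num)⟩

/-- The probability `η_i = ∏ k, λ_{b_k(i)}`. -/
noncomputable def etaEx (d m s t : ℕ) (i : Fin (2 ^ t)) : ℝ :=
  ∏ k : Fin t, lam d m s (bdig i k)

/-- The state `ρ_i = ⊗ k, σ_{b_k(i)}`. -/
noncomputable def rhoEx (d m s t : ℕ) (i : Fin (2 ^ t)) :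
    Matrix (Fin t → Fin s → Fin m → Fin d) (Fin t → Fin s → Fin m → Fin d) ℂ :=
  Matrix.of fun x y => ∏ k, sig d m s (bdig i k) (x k) (y k)

/-- Partial transposition with respect to the parties in `S`, acting simultaneously on all
`t·s` GHZ-factors. -/
def ptS3 {d m s t : ℕ} (S : Finset (Fin m))
    (ρ : Matrix (Fin t → Fin s → Fin m → Fin d) (Fin t → Fin s → Fin m → Fin d) ℂ) :
    Matrix (Fin t → Fin s → Fin m → Fin d) (Fin t → Fin s → Fin m → Fin d) ℂ :=
  Matrix.of fun x y =>
    ρ (fun k l j => if j ∈ S then y k l j else x k l j)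
      (fun k l j => if j ∈ S then x k l j else y k l j)

/-- The matrix Kronecker product of a finite family of matrices. -/
def piKronecker {ι α : Type*} [Fintype ι] (M : ι → Matrix α α ℂ) :
    Matrix (ι → α) (ι → α) ℂ :=
  Matrix.of fun x y => ∏ k, M k (x k) (y k)

open scoped MatrixOrder in
lemma piKronecker_posSemidef {ι α : Type*} [Fintype ι] [DecidableEq ι] [Fintype α]
    [DecidableEq α] {M : ι → Matrix α α ℂ} (hM : ∀ k, (M k).PosSemidef) :
    (piKronecker M).PosSemidef := by
  have h : ∀ k, ∃ B : Matrix α α ℂ, M k = Bᴴ * B := fun k =>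
    CStarAlgebra.nonneg_iff_eq_star_mul_self.mp (hM k).nonneg
  choose B hB using h
  have : piKronecker M = (piKronecker B)ᴴ * piKronecker B := by
    ext x y
    simp only [piKronecker, Matrix.of_apply, Matrix.mul_apply, Matrix.conjTranspose_apply, hB,
      star_prod, ← Finset.prod_mul_distrib]
    rw [Finset.prod_univ_sum, Fintype.piFinset_univ]
  rw [this]
  exact Matrix.posSemidef_conjTranspose_mul_self _

lemma posSemidef_of_sum_norm_le_diag {α : Type*} [Fintype α] [DecidableEq α]
    {A : Matrix α α ℂ} (hA : A.IsHermitian)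
    (h : ∀ k, ∑ j ∈ Finset.univ.erase k, ‖A k j‖ ≤ (A k k).re) : A.PosSemidef := by
  rw [hA.posSemidef_iff_eigenvalues_nonneg]
  intro i
  have hev : Module.End.HasEigenvalue (Matrix.toLin' A) (hA.eigenvalues i : ℂ) := by
    rw [Module.End.hasEigenvalue_iff_mem_spectrum, Matrix.spectrum_toLin']
    exact hA.eigenvalues_mem_spectrum_real i
  obtain ⟨k, hk⟩ := eigenvalue_mem_ball hev
  rw [Metric.mem_closedBall, dist_eq_norm] at hk
  have h1 := (abs_le.mp ((Complex.abs_re_le_norm _).trans (hk.trans (h k)))).1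
  simp only [Complex.sub_re, Complex.ofReal_re] at h1
  show (0 : ℝ) ≤ _
  linarith

/-- Exchange the coordinates in `S` of two functions, returning the first one. -/
def swapOn {β γ : Type*} [DecidableEq β] (S : Finset β) (x y : β → γ) : β → γ :=
  fun j => if j ∈ S then y j else x j

/-- The partial transpose of `1 - 2|GHZ⟩⟨GHZ|` over the parties in `S`. -/
noncomputable def ptReflection (d m : ℕ) (S : Finset (Fin m)) :
    Matrix (Fin m → Fin d) (Fin m → Fin d) ℂ :=
  Matrix.of fun x y =>
    ((1 : Matrix (Fin m → Fin d) (Fin m → Fin d) ℂ) - (2 : ℂ) • ghz d m)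
      (swapOn S x y) (swapOn S y x)

lemma swapOn_eq_iff {β γ : Type*} [DecidableEq β] (S : Finset β) (x y : β → γ) :
    swapOn S x y = swapOn S y x ↔ x = y := by
  constructor
  · intro h
    funext j
    have := congrFun h j
    by_cases hj : j ∈ S <;> simp_all [swapOn]
  · rintro rfl; rfl

lemma ptReflection_eq (d m : ℕ) (S : Finset (Fin m)) :
    ptReflection d m S =
      1 - (2 : ℂ) • Matrix.of fun x y => ghz d m (swapOn S x y) (swapOn S y x) := by
  ext x y
  simp [ptReflection, Matrix.one_apply, swapOn_eq_iff]

lemma ghz_symm (d m : ℕ) (x y : Fin m → Fin d) : ghz d m x y = ghz d m y x := by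
  simp only [ghz, Matrix.of_apply, and_comm]

lemma norm_ghz_swapOn_le {d m : ℕ} {S : Finset (Fin m)} {j₀ j₁ : Fin m} (h₀ : j₀ ∈ S)
    (h₁ : j₁ ∉ S) (x y : Fin m → Fin d) :
    ‖ghz d m (swapOn S x y) (swapOn S y x)‖ ≤
      if y = swapOn S (fun _ => x j₀) (fun _ => x j₁) then (1 / d : ℝ) else 0 := by
  simp only [ghz, Matrix.of_apply]
  split_ifs with h h'
  · simp
  · obtain ⟨⟨a, ha⟩, b, hb⟩ := h
    refine absurd (funext fun j => ?_) h'
    have ha₁ := ha j₁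
    have hb₀ := hb j₀
    have haj := ha j
    have hbj := hb j
    by_cases hj : j ∈ S <;> simp_all [swapOn]
  · simp
  · simp

lemma ptReflection_posSemidef {d m : ℕ} (hd : 2 ≤ d) {S : Finset (Fin m)} (hS : S.Nonempty)
    (hS' : S ≠ Finset.univ) : (ptReflection d m S).PosSemidef := by
  obtain ⟨j₀, h₀⟩ := hS
  obtain ⟨j₁, h₁⟩ : ∃ j, j ∉ S := by
    by_contra! h
    exact hS' (Finset.eq_univ_iff_forall.mpr h)
  set Q : Matrix (Fin m → Fin d) (Fin m → Fin d) ℂ :=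
    Matrix.of fun x y => ghz d m (swapOn S x y) (swapOn S y x) with hQ
  have hrow : ∀ x, ∑ y, ‖Q x y‖ ≤ 1 / 2 := fun x => by
    calc ∑ y, ‖Q x y‖ ≤ ∑ y, if y = swapOn S (fun _ => x j₀) (fun _ => x j₁)
          then (1 / d : ℝ) else 0 :=
          Finset.sum_le_sum fun y _ => norm_ghz_swapOn_le h₀ h₁ x y
      _ = 1 / d := by simp
      _ ≤ 1 / 2 := by
          have : (2 : ℝ) ≤ d := by exact_mod_cast hd
          gcongr
  have hQstar : Qᴴ = Q := by
    ext x y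
    simp only [hQ, Matrix.conjTranspose_apply, Matrix.of_apply]
    rw [ghz_symm]
    simp only [ghz, Matrix.of_apply]
    split_ifs <;> simp
  rw [ptReflection_eq, ← hQ]
  refine posSemidef_of_sum_norm_le_diag ?_ fun x => ?_
  · simp [Matrix.IsHermitian, Matrix.conjTranspose_sub, Matrix.conjTranspose_smul, hQstar]
  · have h1 : ∑ y ∈ Finset.univ.erase x, ‖(1 - (2 : ℂ) • Q) x y‖
        = ∑ y ∈ Finset.univ.erase x, 2 * ‖Q x y‖ := by
      refine Finset.sum_congr rfl fun y hy => ?_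
      simp [Matrix.one_apply_ne (Finset.ne_of_mem_erase hy).symm]
    have h2 := Finset.add_sum_erase Finset.univ (fun y => ‖Q x y‖) (Finset.mem_univ x)
    have h3 := hrow x
    have h4 := Complex.re_le_norm (Q x x)
    rw [h1, ← Finset.mul_sum]
    simp only [Matrix.sub_apply, Matrix.one_apply_eq, Matrix.smul_apply, smul_eq_mul,
      Complex.sub_re, Complex.one_re, Complex.mul_re, Complex.re_ofNat, Complex.im_ofNat]
    linarith

/-- A product of sums `1 + P` dominates the products of `1 ± P`. -/
lemma piKronecker_one_add_sub_posSemidef {ι α : Type*} [Fintype ι] [DecidableEq ι] [Fintype α]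
    [DecidableEq α] {P : Matrix α α ℂ} (hP : P.PosSemidef) {ε : ι → ℝ} (hε : ∀ k, |ε k| ≤ 1) :
    (piKronecker (fun _ : ι => 1 + P) - piKronecker fun k => 1 + ε k • P).PosSemidef := by
  have key : ∀ ε : ι → ℝ, piKronecker (fun k => 1 + ε k • P) =
      ∑ β : ι → Fin 2, (∏ k, ε k ^ (β k).val) • piKronecker fun k => P ^ (β k).val := by
    intro ε
    ext x y
    have h : ∀ k, (1 + ε k • P) (x k) (y k) =
        ∑ b : Fin 2, (ε k ^ b.val) • (P ^ b.val) (x k) (y k) := fun k => by simp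
    simp only [piKronecker, Matrix.of_apply, h, Matrix.sum_apply, Matrix.smul_apply]
    rw [Finset.prod_univ_sum, Fintype.piFinset_univ]
    refine Finset.sum_congr rfl fun β _ => ?_
    simp [Finset.prod_mul_distrib]
  have h1 := key fun _ => 1
  simp only [one_smul, one_pow, Finset.prod_const_one] at h1
  rw [h1, key, ← Finset.sum_sub_distrib]
  refine Matrix.posSemidef_sum _ fun β _ => ?_
  rw [← one_smul ℝ (piKronecker fun k => P ^ (β k).val), smul_smul, ← sub_smul]
  refine Matrix.PosSemidef.smul (piKronecker_posSemidef fun k => hP.pow _) ?_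
  have : |∏ k, ε k ^ (β k).val| ≤ 1 := by
    rw [Finset.abs_prod]
    refine Finset.prod_le_one (fun _ _ => abs_nonneg _) fun k _ => ?_
    rw [abs_pow]
    exact pow_le_one₀ (abs_nonneg _) (hε k)
  have := (abs_le.mp this).2
  linarith

lemma lam_smul_sig {d m s : ℕ} (hd : 2 ≤ d) (hm : 2 ≤ m) (hs : 1 ≤ s) (b : Fin 2) :
    lam d m s b • sig d m s b =
      (2 * (d : ℝ) ^ (m * s))⁻¹ • (1 + (![1, -1] b : ℝ) • piOne d m s) := by
  have hd' : (2 : ℝ) ≤ d := by exact_mod_cast hd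
  have h4 : (4 : ℝ) ≤ (d : ℝ) ^ m :=
    calc (4 : ℝ) = 2 ^ 2 := by norm_num
      _ ≤ (d : ℝ) ^ 2 := by gcongr
      _ ≤ (d : ℝ) ^ m := pow_le_pow_right₀ (by linarith) hm
  have hlt : ((d : ℝ) ^ m - 2) ^ s < (d : ℝ) ^ (m * s) := by
    rw [pow_mul]
    exact pow_lt_pow_left₀ (by linarith) (by linarith) (by omega)
  have hpos : 0 < ((d : ℝ) ^ m - 2) ^ s := pow_pos (by linarith) _
  have hadd : (d : ℝ) ^ (m * s) + ((d : ℝ) ^ m - 2) ^ s ≠ 0 := by linarith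
  have hsub : (d : ℝ) ^ (m * s) - ((d : ℝ) ^ m - 2) ^ s ≠ 0 := by linarith
  fin_cases b
  · simp only [lam, sig, Fin.zero_eta, Matrix.cons_val_zero, smul_smul, one_smul]
    congr 1
    field_simp
  · simp only [lam, sig, Fin.mk_one, Matrix.cons_val_one, Matrix.cons_val_fin_one, smul_smul,
      neg_smul, one_smul, ← sub_eq_add_neg]
    congr 1
    field_simp

lemma etaEx_smul_ptS3_rhoEx {d m s t : ℕ} (hd : 2 ≤ d) (hm : 2 ≤ m) (hs : 1 ≤ s)
    (S : Finset (Fin m)) (i : Fin (2 ^ t)) :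
    etaEx d m s t i • ptS3 S (rhoEx d m s t i) =
      ((2 * (d : ℝ) ^ (m * s))⁻¹ ^ t) • piKronecker fun k : Fin t =>
        1 + (![1, -1] (bdig i k) : ℝ) • piKronecker fun _ : Fin s => ptReflection d m S := by
  ext x y
  have h1 : ∀ k : Fin t, (1 : Matrix (Fin s → Fin m → Fin d) (Fin s → Fin m → Fin d) ℂ)
      (fun l => swapOn S (x k l) (y k l)) (fun l => swapOn S (y k l) (x k l)) =
      (1 : Matrix (Fin s → Fin m → Fin d) (Fin s → Fin m → Fin d) ℂ) (x k) (y k) := fun k => by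
    simp only [Matrix.one_apply, funext_iff (f := fun l => swapOn S (x k l) (y k l)),
      swapOn_eq_iff, funext_iff (f := x k)]
  have h2 : ∀ k : Fin t, lam d m s (bdig i k) • sig d m s (bdig i k)
      (fun l => swapOn S (x k l) (y k l)) (fun l => swapOn S (y k l) (x k l)) =
      (2 * (d : ℝ) ^ (m * s))⁻¹ • (1 + (![1, -1] (bdig i k) : ℝ) •
        piKronecker fun _ : Fin s => ptReflection d m S) (x k) (y k) := fun k => by
    rw [← Matrix.smul_apply, lam_smul_sig hd hm hs, Matrix.smul_apply, Matrix.add_apply,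
      Matrix.add_apply, h1]
    rfl
  calc (etaEx d m s t i • ptS3 S (rhoEx d m s t i)) x y
      = ∏ k : Fin t, lam d m s (bdig i k) • sig d m s (bdig i k)
          (fun l => swapOn S (x k l) (y k l)) (fun l => swapOn S (y k l) (x k l)) := by
        simp only [etaEx, Complex.real_smul, Finset.prod_mul_distrib, Matrix.smul_apply,
          Complex.ofReal_prod]
        rfl
    _ = _ := by
        rw [Finset.prod_congr rfl fun k _ => h2 k]
        simp only [Complex.real_smul, Finset.prod_mul_distrib, Matrix.smul_apply, piKronecker,
          Matrix.of_apply, Finset.prod_const, Finset.card_univ, Fintype.card_fin,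
          Complex.ofReal_pow]

theorem stmt16 (d m s t : ℕ) (hd : 2 ≤ d) (hm : 2 ≤ m) (hs : 1 ≤ s) (ht : 1 ≤ t)
    (S : Finset (Fin m)) (hS : S.Nonempty) (hS' : S ≠ Finset.univ) (i : Fin (2 ^ t)) :
    (etaEx d m s t ⟨0, Nat.two_pow_pos t⟩ • ptS3 S (rhoEx d m s t ⟨0, Nat.two_pow_pos t⟩)
      - etaEx d m s t i • ptS3 S (rhoEx d m s t i)).PosSemidef := by
  have h0 : ∀ k : Fin t, (![1, -1] (bdig (⟨0, Nat.two_pow_pos t⟩ : Fin (2 ^ t)) k) : ℝ) = 1 := by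
    intro k
    simp [bdig]
  rw [etaEx_smul_ptS3_rhoEx hd hm hs, etaEx_smul_ptS3_rhoEx hd hm hs, ← smul_sub]
  simp only [h0, one_smul]
  refine Matrix.PosSemidef.smul (piKronecker_one_add_sub_posSemidef
    (piKronecker_posSemidef fun _ => ptReflection_posSemidef hd hS hS') fun k => ?_)
    (by positivity)
  generalize bdig i k = b
  fin_cases b <;> simp
end
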